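/- arXiv:2209.03529 — 4 statements merged into one kernel-verified Lean document; each statement's English description precedes it below -/
import Mathlib

section
/- Let G be a group, T ⊆ G a symmetric subset, A ⊆ G a symmetric subset, and μ a left-invariant T-rough measure on G normalised at A. Let m ≥ 1 and suppose 0 < μ(A^{2m}) < ∞. Let t > 0 be an integer and B ⊆ A^m a subset with μ(B) ≥ 2μ(A^{2m})/t. Then the set S(B) = {g ∈ A^{2m} : μ(B ∩ gBT) ≥ 2μ(A^{2m})/t² and μ(gB ∩ BT) ≥ 2μ(A^{2m})/t²} is t-thick in A^m. -/
open scoped Pointwise ENNReal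

/-- `Y` is `t`-thick in `X`: among any `t+1` elements of `X` there are two distinct
ones, `gᵢ` and `gⱼ`, with `gᵢ⁻¹ * gⱼ ∈ Y`. -/
def IsThick {G : Type*} [Group G] (t : ℕ) (Y X : Set G) : Prop :=
  ∀ g : Fin (t + 1) → G, (∀ i, g i ∈ X) → ∃ i j, i ≠ j ∧ (g i)⁻¹ * g j ∈ Y

/-- The value of a monotone subadditive set function on `X` is at most its value on what is left of `X` after
deleting finitely many sets, plus its values on the deleted parts. -/
theorem le_diff_biUnion_add_sum {α ι : Type*} {μ : Set α → ℝ≥0∞}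
    (hmono : ∀ X Y : Set α, X ⊆ Y → μ X ≤ μ Y)
    (hsub : ∀ X Y : Set α, μ (X ∪ Y) ≤ μ X + μ Y)
    (X : Set α) (Z : ι → Set α) (s : Finset ι) :
    μ X ≤ μ (X \ ⋃ j ∈ s, Z j) + ∑ j ∈ s, μ (X ∩ Z j) := by
  classical
  induction s using Finset.induction_on with
  | empty => simp
  | insert a s ha ih =>
    rw [Finset.sum_insert ha, ← add_assoc]
    refine ih.trans (add_le_add_left ((hmono _ _ ?_).trans (hsub _ _)) _)
    intro x hx
    simp only [Set.mem_sdiff, Set.mem_iUnion, Set.mem_union, Set.mem_inter_iff,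
      Finset.mem_insert] at hx ⊢
    grind

/-- A function on sets that is additive modulo `T` is finitely superadditive on families of sets
that are pairwise disjoint modulo `T`. -/
theorem sum_le_biUnion_of_additive_mod {G ι : Type*} [Group G] {T : Set G} {μ : Set G → ℝ≥0∞}
    (hadd : ∀ Y Z : Set G, Y ∩ (Z * T) = ∅ → μ (Y ∪ Z) = μ Y + μ Z)
    (Y : ι → Set G) (hY : ∀ i j, i ≠ j → Y i ∩ (Y j * T) = ∅) (s : Finset ι) :
    ∑ i ∈ s, μ (Y i) ≤ μ (⋃ i ∈ s, Y i) := by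
  classical
  induction s using Finset.induction_on with
  | empty => simp
  | insert a s ha ih =>
    rw [Finset.sum_insert ha, Finset.set_biUnion_insert, hadd]
    · exact add_le_add_right ih _
    · simp only [Set.iUnion_mul, Set.inter_iUnion, Set.iUnion_eq_empty]
      intro j hj
      exact hY a j fun h => ha (h ▸ hj)

/-- Being disjoint modulo a symmetric set is a symmetric relation. -/
theorem inter_mul_eq_empty_symm {G : Type*} [Group G] {T X Y : Set G} (hT : T⁻¹ = T)
    (h : X ∩ (Y * T) = ∅) : Y ∩ (X * T) = ∅ := by
  rw [Set.eq_empty_iff_forall_notMem] at h ⊢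
  rintro _ ⟨hy, x, hx, u, hu, rfl⟩
  refine h x ⟨hx, x * u, hy, u⁻¹, ?_, by simp⟩
  rwa [← hT, Set.inv_mem_inv]

/-- A tournament on `Fin (t + 1)` has `(t + 1) * t / 2` arcs. -/
theorem two_mul_sum_card_tournament (t : ℕ) (r : Fin (t + 1) → Fin (t + 1) → Prop)
    [DecidableRel r] (hirr : ∀ i, ¬ r i i) (hr : ∀ i j, i ≠ j → (r i j ↔ ¬ r j i)) :
    2 * ∑ i, (Finset.univ.filter (r i)).card = (t + 1) * t := by
  have h : ∀ i, (Finset.univ.filter (r i)).card + (Finset.univ.filter fun j => r j i).card = t := by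
    intro i
    rw [← Finset.card_union_of_disjoint]
    · have : Finset.univ.filter (r i) ∪ Finset.univ.filter (fun j => r j i)
          = Finset.univ.erase i := by
        ext j
        simp only [Finset.mem_union, Finset.mem_filter, Finset.mem_univ, true_and,
          Finset.mem_erase, and_true]
        grind
      simp [this]
    · rw [Finset.disjoint_filter]
      grind
  have hswap : ∑ i, (Finset.univ.filter fun j => r j i).card
      = ∑ i, (Finset.univ.filter (r i)).card := by
    simp only [Finset.card_filter]
    exact Finset.sum_comm
  have hsum := Finset.sum_congr (rfl : (Finset.univ : Finset (Fin (t + 1))) = _)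
    fun i _ => h i
  rw [Finset.sum_add_distrib, hswap] at hsum
  simp at hsum
  lia

/-- If μ is a left-invariant T-rough measure normalised at the symmetric
set A, with 0 < μ(A^{2m}) < ∞, t > 0 and B ⊆ A^m satisfies μ(B) ≥ 2μ(A^{2m})/t, then
S(B) = {g ∈ A^{2m} : μ(B ∩ gBT) ≥ 2μ(A^{2m})/t² and μ(gB ∩ BT) ≥ 2μ(A^{2m})/t²}
is t-thick in A^m. -/
theorem SB_thick {G : Type*} [Group G] (T A : Set G)
    (hT1 : (1 : G) ∈ T) (hTsym : T⁻¹ = T)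
    (hA1 : (1 : G) ∈ A) (hAsym : A⁻¹ = A)
    (μ : Set G → ℝ≥0∞)
    (hmono : ∀ X Y : Set G, X ⊆ Y → μ X ≤ μ Y)
    (hsub : ∀ X Y : Set G, μ (X ∪ Y) ≤ μ X + μ Y)
    (hadd : ∀ Y Z : Set G, Y ∩ (Z * T) = ∅ → μ (Y ∪ Z) = μ Y + μ Z)
    (hinv : ∀ (g : G) (X : Set G), μ (g • X) = μ X)
    (hnorm : μ A = 1)
    (m : ℕ) (hm : 1 ≤ m)
    (hpos : 0 < μ (A ^ (2 * m))) (hfin : μ (A ^ (2 * m)) < ⊤)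
    (t : ℕ) (ht : 0 < t)
    (B : Set G) (hB : B ⊆ A ^ m)
    (hμB : 2 * μ (A ^ (2 * m)) / (t : ℝ≥0∞) ≤ μ B) :
    IsThick t
      {g ∈ A ^ (2 * m) |
        2 * μ (A ^ (2 * m)) / ((t : ℝ≥0∞) ^ 2) ≤ μ (B ∩ ((g • B) * T)) ∧
        2 * μ (A ^ (2 * m)) / ((t : ℝ≥0∞) ^ 2) ≤ μ ((g • B) ∩ (B * T))}
      (A ^ m) := by
  classical
  intro g hg
  by_contra hcon
  push Not at hcon
  set M := μ (A ^ (2 * m)) with hM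
  set c := 2 * M / (t : ℝ≥0∞) ^ 2 with hc
  have htwo : A ^ (2 * m) = A ^ m * A ^ m := by rw [two_mul, pow_add]
  have hAm : (A ^ m)⁻¹ = A ^ m := by rw [← inv_pow, hAsym]
  have hshift (i j) (X : Set G) : g i • (((g i)⁻¹ * g j) • X) = g j • X := by
    rw [smul_smul, mul_inv_cancel_left]
  have hsmall (i j) (hij : i ≠ j) :
      μ ((g i • B) ∩ ((g j • B) * T)) < c ∨ μ ((g j • B) ∩ ((g i • B) * T)) < c := by
    by_contra! h
    refine hcon i j hij ⟨?_, ?_, ?_⟩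
    · rw [htwo]
      refine Set.mul_mem_mul ?_ (hg j)
      rw [← hAm]
      exact Set.inv_mem_inv.2 (hg i)
    · rw [← hinv (g i), Set.smul_set_inter, ← smul_mul_assoc, hshift]
      exact h.1
    · rw [← hinv (g i), Set.smul_set_inter, ← smul_mul_assoc, hshift]
      exact h.2
  let P (i j : Fin (t + 1)) : Prop := μ ((g i • B) ∩ ((g j • B) * T)) < c
  let r (i j : Fin (t + 1)) : Prop := i < j ∧ P i j ∨ j < i ∧ ¬ P j i
  have hrP (i j) (h : r i j) : P i j := by
    rcases h with h | h
    · exact h.2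
    · exact (hsmall i j h.1.ne').resolve_right h.2
  have hr (i j) (hij : i ≠ j) : r i j ↔ ¬ r j i := by
    rcases lt_or_gt_of_ne hij with h | h <;> simp [r, h, h.not_gt]
  let s (i : Fin (t + 1)) := Finset.univ.filter (r i)
  have hcard : 2 * ∑ i, (s i).card = (t + 1) * t :=
    two_mul_sum_card_tournament t r (fun i => by simp [r]) hr
  let Y (i : Fin (t + 1)) : Set G := (g i • B) \ ⋃ j ∈ s i, (g j • B) * T
  have hYB (i) : Y i ⊆ g i • B := Set.sdiff_subset
  have hYr (i j) (h : r i j) : Y i ∩ (Y j * T) = ∅ := by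
    rw [Set.eq_empty_iff_forall_notMem]
    rintro x ⟨hx, hx'⟩
    exact hx.2 (Set.mem_biUnion (by simpa [s] using h) (Set.mul_subset_mul_right (hYB j) hx'))
  have hY (i j) (hij : i ≠ j) : Y i ∩ (Y j * T) = ∅ := by
    by_cases h : r j i
    · exact inter_mul_eq_empty_symm hTsym (hYr j i h)
    · exact hYr i j ((hr i j hij).2 h)
  have hle (i) : μ B ≤ μ (Y i) + (s i).card * c := by
    rw [← hinv (g i) B, ← nsmul_eq_mul]
    refine (le_diff_biUnion_add_sum hmono hsub _ (fun j => (g j • B) * T) (s i)).trans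
      (add_le_add_right (Finset.sum_le_card_nsmul _ _ _ fun j hj => ?_) _)
    exact (hrP i j (by simpa [s] using hj)).le
  have hUnion : ∑ i, μ (Y i) ≤ M := by
    refine (sum_le_biUnion_of_additive_mod hadd Y hY Finset.univ).trans (hmono _ _ ?_)
    refine Set.iUnion₂_subset fun i _ => (hYB i).trans ?_
    rintro _ ⟨b, hb, rfl⟩
    rw [htwo]
    exact Set.mul_mem_mul (hg i) (hB hb)
  have htotal : ((t + 1 : ℕ) : ℝ≥0∞) * (2 * M / t) ≤ M + ((∑ i, (s i).card : ℕ) : ℝ≥0∞) * c := by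
    calc ((t + 1 : ℕ) : ℝ≥0∞) * (2 * M / t) = ∑ _i : Fin (t + 1), 2 * M / t := by simp
      _ ≤ ∑ i, (μ (Y i) + (s i).card * c) :=
        Finset.sum_le_sum fun i _ => hμB.trans (hle i)
      _ ≤ _ := by
        rw [Finset.sum_add_distrib, Nat.cast_sum, Finset.sum_mul]
        exact add_le_add_left hUnion _
  have ht0 : (t : ℝ≥0∞) ≠ 0 := by exact_mod_cast ht.ne'
  have hcfin : c ≠ ⊤ :=
    ENNReal.div_ne_top (ENNReal.mul_ne_top (by simp) hfin.ne) (pow_ne_zero _ ht0)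
  have hreal := ENNReal.toReal_mono
    (ENNReal.add_ne_top.2 ⟨hfin.ne, ENNReal.mul_ne_top (ENNReal.natCast_ne_top _) hcfin⟩) htotal
  rw [ENNReal.toReal_add hfin.ne (ENNReal.mul_ne_top (ENNReal.natCast_ne_top _) hcfin)] at hreal
  simp only [hc, ENNReal.toReal_mul, ENNReal.toReal_div, ENNReal.toReal_pow,
    ENNReal.toReal_natCast, ENNReal.toReal_ofNat] at hreal
  have hMpos : 0 < M.toReal := ENNReal.toReal_pos hpos.ne' hfin.ne
  have htR : (0 : ℝ) < t := by exact_mod_cast ht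
  have hN : ((∑ i, (s i).card : ℕ) : ℝ) = (t + 1) * t / 2 := by
    rw [eq_div_iff two_ne_zero, mul_comm]
    exact_mod_cast hcard
  rw [hN] at hreal
  push_cast at hreal
  have hdiff : ((t : ℝ) + 1) * (2 * M.toReal / t)
      - (M.toReal + (t + 1) * t / 2 * (2 * M.toReal / t ^ 2)) = M.toReal / t := by
    field_simp
    ring
  linarith [div_pos hMpos htR]
end

section
/- Let P be a nonempty partially ordered set, r ∈ ℕ, and f₀, …, f_{r−1} : P → ℝ monotone increasing functions (x ≤ y implies f_i(x) ≤ f_i(y)). Suppose there are real numbers a, b > 0 such that a ≤ f_i(x) ≤ b for all i < r and x ∈ P. Then for any real numbers ε₀, …, ε_{r−1} > 0 there is x ∈ P such that for every y ∈ P with y < x and every i < r, f_i(y) > (1 − ε_i)·f_i(x). -/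
/-- Let P be a nonempty poset and f₀, …, f_{r−1} : P → ℝ monotone
increasing functions with a ≤ fᵢ(x) ≤ b for some a, b > 0. Then for any ε₀, …, ε_{r−1} > 0
there is x ∈ P such that for all y < x and all i < r, fᵢ(y) > (1 − εᵢ)·fᵢ(x). -/
theorem sanders_type_lemma {P : Type*} [PartialOrder P] [Nonempty P]
    (r : ℕ) (f : Fin r → P → ℝ)
    (hmono : ∀ i, Monotone (f i))
    (a b : ℝ) (ha : 0 < a) (hb : 0 < b)
    (hbd : ∀ (i : Fin r) (x : P), a ≤ f i x ∧ f i x ≤ b)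
    (ε : Fin r → ℝ) (hε : ∀ i, 0 < ε i) :
    ∃ x : P, ∀ y : P, y < x → ∀ i : Fin r, (1 - ε i) * f i x < f i y := by
  let S : P → ℝ := fun x => ∑ i, f i x / ε i
  have hS : BddBelow (Set.range S) := by
    refine ⟨0, ?_⟩
    rintro _ ⟨x, rfl⟩
    exact Finset.sum_nonneg fun i _ => div_nonneg (ha.le.trans (hbd i x).1) (hε i).le
  obtain ⟨x, hx⟩ := exists_lt_of_ciInf_lt (lt_add_of_pos_right (⨅ x, S x) ha)
  refine ⟨x, fun y hy i => ?_⟩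
  have hxy : S x - S y < a := by linarith [ciInf_le hS y]
  have hsub : S x - S y = ∑ j, (f j x - f j y) / ε j := by
    simp only [S, sub_div, Finset.sum_sub_distrib]
  have hle : (f i x - f i y) / ε i ≤ ∑ j, (f j x - f j y) / ε j :=
    Finset.single_le_sum (f := fun j => (f j x - f j y) / ε j)
      (fun j _ => div_nonneg (sub_nonneg.2 (hmono j hy.le)) (hε j).le) (Finset.mem_univ i)
  have hlt : f i x - f i y < a * ε i := (div_lt_iff₀ (hε i)).1 (by linarith)
  nlinarith [mul_le_mul_of_nonneg_right (hbd i x).1 (hε i).le]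
end

section
/- Let G be a group, A ⊆ G a symmetric subset, and T₀, T₁, T₂, T₃ ⊆ G symmetric subsets such that T_{k+1}T_{k+1} ⊆ T_k and a⁻¹T_{k+1}a ⊆ T_k for every a ∈ A and each k < 3. Let μ be a left-invariant T₃-rough measure on G normalised at A, and let K ∈ ℕ with μ(A⁴) ≤ K. Then A² is a T₀-rough K²-approximate subgroup; that is, there is a finite set E ⊆ G with |E| ≤ K² such that (A²)² ⊆ E·A²·T₀. -/
open scoped Pointwise ENNReal

/-- If `μ A = 1` and `μ (X * A) ≤ K` for a left-invariant `T`-rough measure `μ`, then `K` left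
translates of `A * T * A⁻¹` cover `X`. -/
theorem exists_rough_covering {G : Type*} [Group G] {A X T : Set G}
    (hA1 : (1 : G) ∈ A) (hT1 : (1 : G) ∈ T) {μ : Set G → ℝ≥0∞}
    (hmono : ∀ X Y : Set G, X ⊆ Y → μ X ≤ μ Y)
    (hadd : ∀ Y Z : Set G, Y ∩ (Z * T) = ∅ → μ (Y ∪ Z) = μ Y + μ Z)
    (hinv : ∀ (g : G) (X : Set G), μ (g • X) = μ X)
    (hnorm : μ A = 1) {K : ℕ} (hK : μ (X * A) ≤ (K : ℝ≥0∞)) :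
    ∃ E : Finset G, E.card ≤ K ∧ X ⊆ (E : Set G) * A * T * A⁻¹ := by
  classical
  by_contra! hcover
  have packing : ∀ n : ℕ, ∃ E : Finset G, E.card = n ∧ (E : Set G) ⊆ X ∧
      (n : ℝ≥0∞) ≤ μ ((E : Set G) * A) := by
    intro n
    induction n with
    | zero => exact ⟨∅, by simp⟩
    | succ n ih =>
      obtain ⟨E, hcard, hEX, hn⟩ := ih
      have hEK : E.card ≤ K := by
        rw [hcard]
        exact_mod_cast hn.trans ((hmono _ _ (Set.mul_subset_mul_right hEX)).trans hK)
      obtain ⟨x, hx, hxE⟩ := Set.not_subset.1 (hcover E hEK)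
      have hxE' : x ∉ E := fun h => hxE <| by
        simpa using Set.mul_mem_mul (Set.mul_mem_mul (Set.mul_mem_mul (Finset.mem_coe.2 h) hA1) hT1)
          (Set.inv_mem_inv.2 hA1)
      have hdisj : (x • A) ∩ ((E : Set G) * A * T) = ∅ := by
        rw [Set.eq_empty_iff_forall_notMem]
        rintro _ ⟨⟨a, ha, rfl⟩, h⟩
        exact hxE <| by simpa using Set.mul_mem_mul h (Set.inv_mem_inv.2 ha)
      refine ⟨insert x E, by rw [Finset.card_insert_of_notMem hxE', hcard], ?_, ?_⟩
      · simpa [Set.insert_subset_iff] using ⟨hx, hEX⟩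
      · rw [Finset.coe_insert, Set.insert_eq, Set.union_mul, ← smul_eq_mul, Set.singleton_smul,
          hadd _ _ hdisj, hinv, hnorm]
        push_cast
        rw [add_comm]
        gcongr
  obtain ⟨E, -, hEX, hn⟩ := packing (K + 1)
  have : ((K + 1 : ℕ) : ℝ≥0∞) ≤ K :=
    hn.trans ((hmono _ _ (Set.mul_subset_mul_right hEX)).trans hK)
  have : K + 1 ≤ K := by exact_mod_cast this
  omega

/-- If conjugation by `A` maps `T` into `T'`, then `T` can be moved to the right across `A`. -/
theorem mul_subset_mul_of_conj_mem {G : Type*} [Group G] {A T T' : Set G}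
    (h : ∀ a ∈ A, ∀ x ∈ T, a⁻¹ * x * a ∈ T') : T * A ⊆ A * T' := by
  rintro _ ⟨t, ht, a, ha, rfl⟩
  exact ⟨a, ha, a⁻¹ * t * a, h a ha t ht, by simp [mul_assoc]⟩

/-- Rough Ruzsa covering. If A is symmetric, T₀,…,T₃ are symmetric with
T_{k+1}T_{k+1} ⊆ T_k and a⁻¹T_{k+1}a ⊆ T_k for a ∈ A (k < 3), μ is a left-invariant
T₃-rough measure normalised at A, and μ(A⁴) ≤ K, then A² is a T₀-rough K²-approximate
subgroup: there is E with |E| ≤ K² and (A²)² ⊆ E·A²·T₀. -/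
theorem rough_ruzsa {G : Type*} [Group G] (A : Set G)
    (hA1 : (1 : G) ∈ A) (hAsym : A⁻¹ = A)
    (T₀ T₁ T₂ T₃ : Set G)
    (hT₀1 : (1 : G) ∈ T₀) (hT₀sym : T₀⁻¹ = T₀)
    (hT₁1 : (1 : G) ∈ T₁) (hT₁sym : T₁⁻¹ = T₁)
    (hT₂1 : (1 : G) ∈ T₂) (hT₂sym : T₂⁻¹ = T₂)
    (hT₃1 : (1 : G) ∈ T₃) (hT₃sym : T₃⁻¹ = T₃)
    (hsq₀ : T₁ * T₁ ⊆ T₀) (hsq₁ : T₂ * T₂ ⊆ T₁) (hsq₂ : T₃ * T₃ ⊆ T₂)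
    (hconj₀ : ∀ a ∈ A, ∀ x ∈ T₁, a⁻¹ * x * a ∈ T₀)
    (hconj₁ : ∀ a ∈ A, ∀ x ∈ T₂, a⁻¹ * x * a ∈ T₁)
    (hconj₂ : ∀ a ∈ A, ∀ x ∈ T₃, a⁻¹ * x * a ∈ T₂)
    (μ : Set G → ℝ≥0∞)
    (hmono : ∀ X Y : Set G, X ⊆ Y → μ X ≤ μ Y)
    (hsub : ∀ X Y : Set G, μ (X ∪ Y) ≤ μ X + μ Y)
    (hadd : ∀ Y Z : Set G, Y ∩ (Z * T₃) = ∅ → μ (Y ∪ Z) = μ Y + μ Z)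
    (hinv : ∀ (g : G) (X : Set G), μ (g • X) = μ X)
    (hnorm : μ A = 1)
    (K : ℕ) (hK : μ (A ^ 4) ≤ (K : ℝ≥0∞)) :
    ∃ E : Finset G, E.card ≤ K ^ 2 ∧ (A ^ 2) ^ 2 ⊆ (E : Set G) * (A ^ 2) * T₀ := by
  classical
  obtain ⟨E, hE, hcov⟩ := exists_rough_covering (X := A ^ 3) hA1 hT₃1 hmono hadd hinv hnorm
    (by rwa [← pow_succ])
  have hA3 : A ^ 3 ⊆ (E : Set G) * A ^ 2 * T₂ :=
    calc A ^ 3 ⊆ (E : Set G) * A * (T₃ * A) := by rwa [hAsym, mul_assoc _ T₃] at hcov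
      _ ⊆ (E : Set G) * A * (A * T₂) := Set.mul_subset_mul_left (mul_subset_mul_of_conj_mem hconj₂)
      _ = (E : Set G) * A ^ 2 * T₂ := by simp only [pow_two, mul_assoc]
  have hT₂₁ : T₂ ⊆ T₁ := (Set.subset_mul_left T₂ hT₂1).trans hsq₁
  refine ⟨E * E, Finset.card_mul_le.trans ?_, ?_⟩
  · rw [pow_two]
    gcongr
  calc (A ^ 2) ^ 2 = A ^ 3 * A := by rw [← pow_mul, ← pow_succ]
    _ ⊆ (E : Set G) * A ^ 2 * T₂ * A := by gcongr
    _ = (E : Set G) * A ^ 2 * (T₂ * A) := mul_assoc _ _ _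
    _ ⊆ (E : Set G) * A ^ 2 * (A * T₁) := Set.mul_subset_mul_left (mul_subset_mul_of_conj_mem hconj₁)
    _ = (E : Set G) * A ^ 3 * T₁ := by simp only [pow_succ, pow_zero, one_mul, mul_assoc]
    _ ⊆ (E : Set G) * ((E : Set G) * A ^ 2 * T₁) * T₁ := by
      gcongr
      exact hA3.trans (Set.mul_subset_mul_left hT₂₁)
    _ = ((E * E : Finset G) : Set G) * A ^ 2 * (T₁ * T₁) := by
      simp only [Finset.coe_mul, mul_assoc]
    _ ⊆ ((E * E : Finset G) : Set G) * A ^ 2 * T₀ := by gcongr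
end

section
/- Let G be a group, A ⊆ G a symmetric subset, and (T_i)_{i∈ℕ} a sequence of symmetric subsets of G such that T_{i+1}T_{i+1} ⊆ T_i and a⁻¹T_{i+1}a ⊆ T_i for every a ∈ A and all i ∈ ℕ. For each i ∈ ℕ let μ_i be a left-invariant T_i-rough measure on G normalised at A. Suppose that for every i ∈ ℕ there exists j ∈ ℕ such that μ_i(A⁴T_j) < ∞. Then μ_i(A^m) < ∞ for all i, m ∈ ℕ. -/
open scoped Pointwise ENNReal

section RoughMeasure

variable {G : Type*} [Group G]

/-- The measure of finitely many translates of a set of finite measure is finite. -/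
theorem measure_finite_mul_lt_top (ν : Set G → ℝ≥0∞)
    (hmono : ∀ X Y : Set G, X ⊆ Y → ν X ≤ ν Y)
    (hsub : ∀ X Y : Set G, ν (X ∪ Y) ≤ ν X + ν Y)
    (hinv : ∀ (g : G) (X : Set G), ν (g • X) = ν X)
    {F X : Set G} (hF : F.Finite) (hX : ν X < ⊤) : ν (F * X) < ⊤ := by
  induction F, hF using Set.Finite.induction_on with
  | empty => exact (hmono _ X (by simp)).trans_lt hX
  | @insert a F _ _ ih =>
    rw [Set.insert_eq, Set.union_mul, Set.singleton_mul]
    refine (hsub _ _).trans_lt (ENNReal.add_lt_top.2 ⟨?_, ih⟩)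
    exact (hinv a X).trans_lt hX

/-- A rough version of Ruzsa's covering lemma. -/
theorem exists_finite_subset_mul_mul_inv (A B S : Set G) (ν : Set G → ℝ≥0∞)
    (hmono : ∀ X Y : Set G, X ⊆ Y → ν X ≤ ν Y)
    (hadd : ∀ Y Z : Set G, Y ∩ (Z * S) = ∅ → ν (Y ∪ Z) = ν Y + ν Z)
    (hinv : ∀ (g : G) (X : Set G), ν (g • X) = ν X)
    (hnorm : ν A = 1) (hfin : ν (B * A) < ⊤) :
    ∃ F : Set G, F.Finite ∧ B ⊆ F * A * S * A⁻¹ := by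
  by_contra! hcover
  have hlarge : ∀ n : ℕ, ∃ F : Set G, F.Finite ∧ F ⊆ B ∧ (n : ℝ≥0∞) ≤ ν (F * A) := by
    intro n
    induction n with
    | zero => exact ⟨∅, Set.finite_empty, Set.empty_subset _, by simp⟩
    | succ n ih =>
      obtain ⟨F, hF, hFB, hn⟩ := ih
      obtain ⟨x, hxB, hx⟩ := Set.not_subset.1 (hcover F hF)
      refine ⟨insert x F, hF.insert x, Set.insert_subset hxB hFB, ?_⟩
      have hdisj : (x • A) ∩ (F * A * S) = ∅ := by
        rw [Set.eq_empty_iff_forall_notMem]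
        rintro _ ⟨⟨a, ha, rfl⟩, h⟩
        exact hx ⟨x * a, h, a⁻¹, Set.inv_mem_inv.2 ha, by simp⟩
      have hunion : insert x F * A = x • A ∪ F * A := by
        rw [Set.insert_eq, Set.union_mul, Set.singleton_mul]
        rfl
      rw [hunion, hadd _ _ hdisj, hinv, hnorm, Nat.cast_succ, add_comm]
      gcongr
  obtain ⟨n, hn⟩ := ENNReal.exists_nat_gt hfin.ne
  obtain ⟨F, -, hFB, hF⟩ := hlarge n
  exact absurd (hF.trans (hmono _ _ (Set.mul_subset_mul_right hFB))) hn.not_ge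

end RoughMeasure

/-- Let A be symmetric and (T_i) a sequence of symmetric subsets with
T_{i+1}T_{i+1} ⊆ T_i and a⁻¹T_{i+1}a ⊆ T_i for a ∈ A. Let each μ_i be a left-invariant
T_i-rough measure normalised at A. If for every i there is j with μ_i(A⁴T_j) < ∞,
then μ_i(A^m) < ∞ for all i, m. -/
theorem rough_finiteness {G : Type*} [Group G] (A : Set G)
    (hA1 : (1 : G) ∈ A) (hAsym : A⁻¹ = A)
    (T : ℕ → Set G)
    (hT1 : ∀ i, (1 : G) ∈ T i) (hTsym : ∀ i, (T i)⁻¹ = T i)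
    (hTsq : ∀ i, T (i + 1) * T (i + 1) ⊆ T i)
    (hTconj : ∀ i, ∀ a ∈ A, ∀ x ∈ T (i + 1), a⁻¹ * x * a ∈ T i)
    (μ : ℕ → Set G → ℝ≥0∞)
    (hmono : ∀ i, ∀ X Y : Set G, X ⊆ Y → μ i X ≤ μ i Y)
    (hsub : ∀ i, ∀ X Y : Set G, μ i (X ∪ Y) ≤ μ i X + μ i Y)
    (hadd : ∀ i, ∀ Y Z : Set G, Y ∩ (Z * T i) = ∅ → μ i (Y ∪ Z) = μ i Y + μ i Z)
    (hinv : ∀ i (g : G) (X : Set G), μ i (g • X) = μ i X)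
    (hnorm : ∀ i, μ i A = 1)
    (hfin : ∀ i, ∃ j, μ i (A ^ 4 * T j) < ⊤) :
    ∀ i m : ℕ, μ i (A ^ m) < ⊤ := by
  have hTA : ∀ i, T (i + 1) * A ⊆ A * T i := by
    rintro i _ ⟨t, ht, a, ha, rfl⟩
    exact ⟨a, ha, a⁻¹ * t * a, hTconj i a ha t ht, by simp [mul_assoc]⟩
  have hpow : ∀ {m n : ℕ}, m ≤ n → A ^ m ⊆ A ^ n := fun h => Set.pow_subset_pow_right hA1 h
  have hcube : ∀ k, ∃ F : Set G, F.Finite ∧ A ^ 3 ⊆ F * (A ^ 2 * T k) := by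
    intro k
    obtain ⟨j, hj⟩ := hfin (k + 1)
    have h4 : μ (k + 1) (A ^ 3 * A) < ⊤ := by
      refine (hmono _ _ _ ?_).trans_lt hj
      rw [← pow_succ]
      exact Set.subset_mul_left _ (hT1 j)
    obtain ⟨F, hF, hcov⟩ := exists_finite_subset_mul_mul_inv A (A ^ 3) (T (k + 1)) (μ (k + 1))
      (hmono _) (hadd _) (hinv _) (hnorm _) h4
    refine ⟨F, hF, hcov.trans ?_⟩
    calc F * A * T (k + 1) * A⁻¹ = F * A * (T (k + 1) * A) := by rw [hAsym, mul_assoc]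
      _ ⊆ F * A * (A * T k) := Set.mul_subset_mul_left (hTA k)
      _ = F * (A ^ 2 * T k) := by simp only [pow_two, mul_assoc]
  have hcover : ∀ m k, ∃ F : Set G, F.Finite ∧ A ^ (m + 3) ⊆ F * (A ^ 2 * T k) := by
    intro m
    induction m with
    | zero => simpa using hcube
    | succ m ih =>
      intro k
      obtain ⟨F, hF, hFcov⟩ := ih (k + 2)
      obtain ⟨F', hF', hFcov'⟩ := hcube (k + 1)
      refine ⟨F * F', hF.mul hF', ?_⟩
      calc A ^ (m + 1 + 3) = A ^ (m + 3) * A := by rw [← pow_succ]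
        _ ⊆ F * (A ^ 2 * T (k + 2)) * A := Set.mul_subset_mul_right hFcov
        _ = F * A ^ 2 * (T (k + 2) * A) := by simp only [mul_assoc]
        _ ⊆ F * A ^ 2 * (A * T (k + 1)) := Set.mul_subset_mul_left (hTA _)
        _ = F * A ^ 3 * T (k + 1) := by simp only [pow_succ, pow_zero, one_mul, mul_assoc]
        _ ⊆ F * (F' * (A ^ 2 * T (k + 1))) * T (k + 1) :=
          Set.mul_subset_mul_right (Set.mul_subset_mul_left hFcov')
        _ = F * F' * (A ^ 2 * (T (k + 1) * T (k + 1))) := by simp only [mul_assoc]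
        _ ⊆ F * F' * (A ^ 2 * T k) :=
          Set.mul_subset_mul_left (Set.mul_subset_mul_left (hTsq k))
  intro i m
  obtain ⟨j, hj⟩ := hfin i
  obtain ⟨F, hF, hFcov⟩ := hcover m j
  have h2 : μ i (A ^ 2 * T j) < ⊤ :=
    (hmono i _ _ (Set.mul_subset_mul_right (hpow (by norm_num)))).trans_lt hj
  exact (hmono i _ _ ((hpow (Nat.le_add_right m 3)).trans hFcov)).trans_lt
    (measure_finite_mul_lt_top (μ i) (hmono i) (hsub i) (hinv i) hF h2)
end
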